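/- An NFA is intersection-saturated if and only if its reverse is locally-saturated: let N be a relational NFA over Σ with L := L(N). N is locally-saturated when z ∈ I_N ↔ L(N_{@z}) ⊆ L(N) for every state z, and (z₁,z₂) ∈ N_a ↔ L(N_{@z₂}) ⊆ a⁻¹L(N_{@z₁}) for every letter a and states z₁, z₂. N is intersection-saturated when (z₁,z₂) ∈ N_a ↔ (∀ words u: z₁ ∈ N_u[I_N] → z₂ ∈ N_{u++[a]}[I_N]) for every letter a and states z₁, z₂, and z ∈ F_N ↔ (∀ words u: z ∈ N_u[I_N] → N_u[I_N] ∩ F_N ≠ ∅) for every state z. Then N is intersection-saturated if and only if rev N is locally-saturated. -/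

import Mathlib

/-- A relational nondeterministic finite automaton over alphabet `σ` with states `Z`. -/
structure RelNFA (σ : Type*) (Z : Type*) where
  /-- initial states -/
  I : Set Z
  /-- final states -/
  F : Set Z
  /-- for each letter, a transition relation -/
  tr : σ → Z → Z → Prop

namespace RelNFA

variable {σ Z : Type*}

/-- `N_w`: the transition relation of the word `w`, with `N_ε` the identity
relation and `N_{u·a} = N_u ; N_a`. -/
def runRel (N : RelNFA σ Z) (w : List σ) : Z → Z → Prop :=
  w.foldl (fun R a => fun z z' => ∃ y, R z y ∧ N.tr a y z') Eq

/-- `N_w[S]`: the relational image of a set of states. -/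
def imgSet (N : RelNFA σ Z) (w : List σ) (S : Set Z) : Set Z :=
  {z' | ∃ z ∈ S, N.runRel w z z'}

/-- The language accepted by `N`: `{w : N_w[I] ∩ F ≠ ∅}`. -/
def lang (N : RelNFA σ Z) : Set (List σ) :=
  {w | (N.imgSet w N.I ∩ N.F).Nonempty}

/-- `L(N_{@z})`: the language accepted by `N` with initial states `{z}`. -/
def langFrom (N : RelNFA σ Z) (z : Z) : Set (List σ) :=
  {w | (N.imgSet w {z} ∩ N.F).Nonempty}

/-- The reverse nfa: swap initial and final states and take converse transitions. -/
def rev (N : RelNFA σ Z) : RelNFA σ Z where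
  I := N.F
  F := N.I
  tr := fun a z z' => N.tr a z' z

end RelNFA

/-- Left quotient of a language by a single letter: `a⁻¹X = {w : [a]++w ∈ X}`. -/
def letterQuot {σ : Type*} (a : σ) (X : Set (List σ)) : Set (List σ) :=
  {w | a :: w ∈ X}

/-- An nfa is locally-saturated when initial states and transitions are as large
as the languages of the individual states permit. -/
def LocallySaturated {σ Z : Type*} (N : RelNFA σ Z) : Prop :=
  (∀ z : Z, z ∈ N.I ↔ N.langFrom z ⊆ N.lang) ∧
  (∀ (a : σ) (z₁ z₂ : Z), N.tr a z₁ z₂ ↔ N.langFrom z₂ ⊆ letterQuot a (N.langFrom z₁))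

/-- An nfa is intersection-saturated when its transitions and final states are as
large as the reachable subsets permit (Kameda–Weiner's intersection rule). -/
def IntersectionSaturated {σ Z : Type*} (N : RelNFA σ Z) : Prop :=
  (∀ (a : σ) (z₁ z₂ : Z), N.tr a z₁ z₂ ↔
    ∀ u : List σ, z₁ ∈ N.imgSet u N.I → z₂ ∈ N.imgSet (u ++ [a]) N.I) ∧
  (∀ z : Z, z ∈ N.F ↔
    ∀ u : List σ, z ∈ N.imgSet u N.I → (N.imgSet u N.I ∩ N.F).Nonempty)

namespace RelNFA

variable {σ Z : Type*}

theorem runRel_concat (N : RelNFA σ Z) (w : List σ) (a : σ) (z z' : Z) :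
    N.runRel (w ++ [a]) z z' ↔ ∃ y, N.runRel w z y ∧ N.tr a y z' := by
  simp [runRel, List.foldl_append]

theorem runRel_cons (N : RelNFA σ Z) (a : σ) (w : List σ) (z z' : Z) :
    N.runRel (a :: w) z z' ↔ ∃ y, N.tr a z y ∧ N.runRel w y z' := by
  induction w using List.reverseRecOn generalizing z' with
  | nil => simp [runRel]
  | append_singleton w b ih =>
    rw [← List.cons_append, runRel_concat]
    simp only [ih, runRel_concat]
    exact ⟨fun ⟨y, ⟨x, hx, hy⟩, hb⟩ => ⟨x, hx, y, hy, hb⟩,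
      fun ⟨x, hx, y, hy, hb⟩ => ⟨y, ⟨x, hx, hy⟩, hb⟩⟩

theorem runRel_rev (N : RelNFA σ Z) (w : List σ) (z z' : Z) :
    N.rev.runRel w z z' ↔ N.runRel w.reverse z' z := by
  induction w generalizing z with
  | nil => exact eq_comm
  | cons a w ih =>
    rw [runRel_cons, List.reverse_cons, runRel_concat]
    simp only [ih]
    exact exists_congr fun y => and_comm

theorem mem_langFrom_rev (N : RelNFA σ Z) (w : List σ) (z : Z) :
    w ∈ N.rev.langFrom z ↔ z ∈ N.imgSet w.reverse N.I := by
  constructor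
  · rintro ⟨y, ⟨x, rfl, hr⟩, hy⟩
    exact ⟨y, hy, (N.runRel_rev w x y).1 hr⟩
  · rintro ⟨y, hy, hr⟩
    exact ⟨y, ⟨z, rfl, (N.runRel_rev w z y).2 hr⟩, hy⟩

theorem mem_lang_rev (N : RelNFA σ Z) (w : List σ) :
    w ∈ N.rev.lang ↔ (N.imgSet w.reverse N.I ∩ N.F).Nonempty := by
  constructor
  · rintro ⟨y, ⟨x, hx, hr⟩, hy⟩
    exact ⟨x, ⟨y, hy, (N.runRel_rev w x y).1 hr⟩, hx⟩
  · rintro ⟨x, ⟨y, hy, hr⟩, hx⟩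
    exact ⟨y, ⟨x, hx, (N.runRel_rev w x y).2 hr⟩, hy⟩

theorem langFrom_rev_subset_lang_rev (N : RelNFA σ Z) (z : Z) :
    N.rev.langFrom z ⊆ N.rev.lang ↔
      ∀ u : List σ, z ∈ N.imgSet u N.I → (N.imgSet u N.I ∩ N.F).Nonempty := by
  simp only [Set.subset_def, mem_langFrom_rev, mem_lang_rev]
  exact (List.reverse_surjective.forall (p := fun u =>
    z ∈ N.imgSet u N.I → (N.imgSet u N.I ∩ N.F).Nonempty)).symm

theorem langFrom_rev_subset_letterQuot (N : RelNFA σ Z) (a : σ) (z₁ z₂ : Z) :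
    N.rev.langFrom z₁ ⊆ letterQuot a (N.rev.langFrom z₂) ↔
      ∀ u : List σ, z₁ ∈ N.imgSet u N.I → z₂ ∈ N.imgSet (u ++ [a]) N.I := by
  simp only [Set.subset_def, letterQuot, Set.mem_ofPred_eq, mem_langFrom_rev, List.reverse_cons]
  exact (List.reverse_surjective.forall (p := fun u =>
    z₁ ∈ N.imgSet u N.I → z₂ ∈ N.imgSet (u ++ [a]) N.I)).symm

end RelNFA

/-- An nfa is intersection-saturated iff its reverse is locally-saturated. -/
theorem intersectionSaturated_iff_rev_locallySaturated {σ Z : Type*}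
    (N : RelNFA σ Z) :
    IntersectionSaturated N ↔ LocallySaturated N.rev := by
  simp only [IntersectionSaturated, LocallySaturated, RelNFA.langFrom_rev_subset_lang_rev,
    RelNFA.langFrom_rev_subset_letterQuot]
  exact ⟨fun ⟨ht, hf⟩ => ⟨hf, fun a z₁ z₂ => ht a z₂ z₁⟩,
    fun ⟨hf, ht⟩ => ⟨fun a z₁ z₂ => ht a z₂ z₁, hf⟩⟩
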